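/- Suppose A, B, C lie on the equator S¹ = {(x,y,0) : x² + y² = 1}, D lies on the closed unit upper hemisphere S²_{≥0}, and the quadruple (A,B,C,D) maximizes |AB| + |BC| + |CA| + |DA| + |DB| + |DC| among all such configurations. If d₁ ≤ d₂ ≤ d₃ ≤ d₄ ≤ d₅ ≤ d₆ is the increasing rearrangement of the six pairwise distances AB, BC, CA, DA, DB, DC, then d₁ ≥ 0.99200, d₂ ≥ 1.21895, d₃ ≥ 4/3, d₄ ≥ √2, d₅ ≥ 1.53137, and d₆ ≥ 1.60947. -/

import Mathlib

/-- Euclidean distance between two points of `ℝ × ℝ × ℝ`. -/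
noncomputable def dist3 (P Q : ℝ × ℝ × ℝ) : ℝ :=
  Real.sqrt ((P.1 - Q.1) ^ 2 + (P.2.1 - Q.2.1) ^ 2 + (P.2.2 - Q.2.2) ^ 2)

/-- The closed unit upper hemisphere `S²_{≥0}`. -/
def upperHemisphere : Set (ℝ × ℝ × ℝ) :=
  {p | p.1 ^ 2 + p.2.1 ^ 2 + p.2.2 ^ 2 = 1 ∧ 0 ≤ p.2.2}

/-- The equator `S¹ = {(x, y, 0) : x² + y² = 1}`. -/
def equator : Set (ℝ × ℝ × ℝ) :=
  {p | p.1 ^ 2 + p.2.1 ^ 2 = 1 ∧ p.2.2 = 0}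

/-- Sum of the six pairwise distances of a quadruple. -/
noncomputable def sumDist (A B C D : ℝ × ℝ × ℝ) : ℝ :=
  dist3 A B + dist3 B C + dist3 C A + dist3 D A + dist3 D B + dist3 D C

lemma dist3_sq (P Q : ℝ × ℝ × ℝ) :
    dist3 P Q ^ 2 = (P.1 - Q.1) ^ 2 + (P.2.1 - Q.2.1) ^ 2 + (P.2.2 - Q.2.2) ^ 2 :=
  Real.sq_sqrt (by positivity)

lemma equator_subset_upperHemisphere : equator ⊆ upperHemisphere := by
  rintro p ⟨h, h0⟩
  exact ⟨by rw [h0]; linarith, h0.ge⟩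

lemma dist3_le_two {P Q : ℝ × ℝ × ℝ} (hP : P ∈ upperHemisphere) (hQ : Q ∈ upperHemisphere) :
    dist3 P Q ≤ 2 := by
  refine abs_le_of_sq_le_sq' ?_ (by norm_num) |>.2
  rw [dist3_sq]
  nlinarith [hP.1, hQ.1, sq_nonneg (P.1 + Q.1), sq_nonneg (P.2.1 + Q.2.1),
    sq_nonneg (P.2.2 + Q.2.2)]

/-- The squared distances between four points of the unit sphere add up to at most `16`. -/
lemma sum_dist3_sq_le {A B C D : ℝ × ℝ × ℝ} (hA : A ∈ upperHemisphere)
    (hB : B ∈ upperHemisphere) (hC : C ∈ upperHemisphere) (hD : D ∈ upperHemisphere) :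
    dist3 A B ^ 2 + dist3 B C ^ 2 + dist3 C A ^ 2 + dist3 D A ^ 2 + dist3 D B ^ 2
      + dist3 D C ^ 2 ≤ 16 := by
  simp only [dist3_sq]
  nlinarith [hA.1, hB.1, hC.1, hD.1, sq_nonneg (A.1 + B.1 + C.1 + D.1),
    sq_nonneg (A.2.1 + B.2.1 + C.2.1 + D.2.1), sq_nonneg (A.2.2 + B.2.2 + C.2.2 + D.2.2)]

/-- The inscribed square of the equator has distance sum `4 + 4√2`. -/
lemma sumDist_square :
    sumDist (1, 0, 0) (0, 1, 0) (-1, 0, 0) (0, -1, 0) = 4 + 4 * √2 := by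
  have h4 : √4 = 2 := by
    rw [show (4 : ℝ) = 2 ^ 2 by norm_num, Real.sqrt_sq (by norm_num)]
  norm_num [sumDist, dist3, h4]
  ring

theorem distance_bounds_of_optimal
    (A B C D : ℝ × ℝ × ℝ)
    (hA : A ∈ equator) (hB : B ∈ equator) (hC : C ∈ equator)
    (hD : D ∈ upperHemisphere)
    (hmax : ∀ A' ∈ equator, ∀ B' ∈ equator, ∀ C' ∈ equator,
      ∀ D' ∈ upperHemisphere, sumDist A' B' C' D' ≤ sumDist A B C D)
    (d₁ d₂ d₃ d₄ d₅ d₆ : ℝ)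
    (hord : d₁ ≤ d₂ ∧ d₂ ≤ d₃ ∧ d₃ ≤ d₄ ∧ d₄ ≤ d₅ ∧ d₅ ≤ d₆)
    (hperm : ({d₁, d₂, d₃, d₄, d₅, d₆} : Multiset ℝ) =
      {dist3 A B, dist3 B C, dist3 C A, dist3 D A, dist3 D B, dist3 D C}) :
    0.99200 ≤ d₁ ∧ 1.21895 ≤ d₂ ∧ 4/3 ≤ d₃ ∧
      Real.sqrt 2 ≤ d₄ ∧ 1.53137 ≤ d₅ ∧ 1.60947 ≤ d₆ := by
  obtain ⟨h12, h23, h34, h45, h56⟩ := hord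
  have uA := equator_subset_upperHemisphere hA
  have uB := equator_subset_upperHemisphere hB
  have uC := equator_subset_upperHemisphere hC
  have hS := hmax (1, 0, 0) (by simp [equator]) (0, 1, 0) (by simp [equator])
    (-1, 0, 0) (by simp [equator]) (0, -1, 0)
    (equator_subset_upperHemisphere (by simp [equator]))
  rw [sumDist_square] at hS
  have hsum : d₁ + d₂ + d₃ + d₄ + d₅ + d₆ = sumDist A B C D := by
    have h := congrArg Multiset.sum hperm
    simp only [Multiset.insert_eq_cons, Multiset.sum_cons, Multiset.sum_singleton] at h
    rw [sumDist]
    linarith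
  have hsq : d₁ ^ 2 + d₂ ^ 2 + d₃ ^ 2 + d₄ ^ 2 + d₅ ^ 2 + d₆ ^ 2 ≤ 16 := by
    have h := congrArg (fun s : Multiset ℝ => (s.map (· ^ 2)).sum) hperm
    simp only [Multiset.insert_eq_cons, Multiset.map_cons, Multiset.map_singleton,
      Multiset.sum_cons, Multiset.sum_singleton] at h
    linarith [sum_dist3_sq_le uA uB uC hD]
  have h6 : d₆ ≤ 2 := by
    have h : d₆ ∈ ({d₁, d₂, d₃, d₄, d₅, d₆} : Multiset ℝ) := by simp
    rw [hperm] at h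
    simp only [Multiset.insert_eq_cons, Multiset.mem_cons, Multiset.mem_singleton] at h
    rcases h with h | h | h | h | h | h <;> rw [h] <;> apply dist3_le_two <;> assumption
  rw [← hsum] at hS
  have hr : √2 ^ 2 = 2 := Real.sq_sqrt (by norm_num)
  have hlo : 1.41421356 < √2 := Real.lt_sqrt_of_sq_lt (by norm_num)
  have hhi : √2 < 1.41421357 := (Real.sqrt_lt' (by norm_num)).2 (by norm_num)
  generalize √2 = r at *
  refine ⟨?_, ?_, ?_, ?_, by linarith, by linarith⟩
  · linarith [sq_nonneg (d₁ - 0.992), sq_nonneg (d₂ - 1.73297), sq_nonneg (d₃ - 1.73297),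
      sq_nonneg (d₄ - 1.73297), sq_nonneg (d₅ - 1.73297), sq_nonneg (d₆ - 1.73297)]
  · linarith [sq_nonneg (d₁ - 1.21895), sq_nonneg (d₂ - 1.21895), sq_nonneg (d₃ - 1.804738),
      sq_nonneg (d₄ - 1.804738), sq_nonneg (d₅ - 1.804738), sq_nonneg (d₆ - 1.804738)]
  · have hmul := mul_le_mul_of_nonneg_left hS (by linarith : 0 ≤ r)
    have key : 0 ≤ (r - 1) * (d₁ + d₂ + d₃ - 4) := by
      linarith [sq_nonneg (d₁ - 4 / 3), sq_nonneg (d₂ - 4 / 3), sq_nonneg (d₃ - 4 / 3),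
        sq_nonneg (d₄ - 4 * r / 3), sq_nonneg (d₅ - 4 * r / 3), sq_nonneg (d₆ - 4 * r / 3)]
    linarith [nonneg_of_mul_nonneg_right key (by linarith)]
  · have key : 0 ≤ (2 - r) * (d₁ + d₂ + d₃ + d₄ - 4 * r) := by
      linarith [sq_nonneg (d₁ - r), sq_nonneg (d₂ - r), sq_nonneg (d₃ - r),
        sq_nonneg (d₄ - r), sq_nonneg (d₅ - 2), sq_nonneg (d₆ - 2)]
    linarith [nonneg_of_mul_nonneg_right key (by linarith)]
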